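/- arXiv:2210.00677 — 2 statements merged into one kernel-verified Lean document; each statement's English description precedes it below -/
import Mathlib

section
/- Lemma (total sojourn-time bound under downward acceleration). Let g > 0, τ_B, τ_F ≥ 0, t ∈ ℝ, and let X₃ : [t−τ_B, t+τ_F] → ℝ be twice differentiable with X₃''(s) ≤ −g/2 for all s ∈ [t−τ_B, t+τ_F]. Set x₃ := X₃(t) ≥ 0 and v₃ := X₃'(t), and assume X₃(t−τ_B) = 0 and X₃(t+τ_F) = 0. Then τ_B + τ_F ≤ (4/g) √(v₃² + g x₃). -/
/-!
Statement 7 (Lemma 4.1(ii)): total sojourn-time bound under downward acceleration.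
-/

/-- **Total sojourn-time bound under downward acceleration.**  If the vertical
component `X₃` of a trajectory has acceleration `≤ −g/2` on `[t−τ_B, t+τ_F]`, passes
through height `x₃ = X₃(t) ≥ 0` with vertical velocity `v₃ = X₃'(t)`, and exits through
the boundary at both ends, then `τ_B + τ_F ≤ (4/g) √(v₃² + g x₃)`. -/
theorem sojourn_time_bound
    (g τB τF t : ℝ) (hg : 0 < g) (hτB : 0 ≤ τB) (hτF : 0 ≤ τF)
    (X X' X'' : ℝ → ℝ)
    (hX : ∀ s ∈ Set.Icc (t - τB) (t + τF),
      HasDerivWithinAt X (X' s) (Set.Icc (t - τB) (t + τF)) s)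
    (hX' : ∀ s ∈ Set.Icc (t - τB) (t + τF),
      HasDerivWithinAt X' (X'' s) (Set.Icc (t - τB) (t + τF)) s)
    (hacc : ∀ s ∈ Set.Icc (t - τB) (t + τF), X'' s ≤ -g / 2)
    (hx3 : 0 ≤ X t)
    (hexitB : X (t - τB) = 0) (hexitF : X (t + τF) = 0) :
    τB + τF ≤ 4 / g * Real.sqrt ((X' t) ^ 2 + g * X t) := by
  set I := Set.Icc (t - τB) (t + τF) with hI
  have hA : AntitoneOn (fun s => X' s - X' t + g / 2 * (s - t)) I := by
    have hd : ∀ s ∈ I, HasDerivWithinAt (fun s => X' s - X' t + g / 2 * (s - t))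
        (X'' s + g / 2 * 1) I s := fun s hs =>
      ((hX' s hs).sub_const _).add
        (((hasDerivWithinAt_id s I).sub_const t).const_mul (g / 2))
    refine antitoneOn_of_hasDerivWithinAt_nonpos (f' := fun s => X'' s + g / 2 * 1)
      (convex_Icc _ _) (fun s hs => (hd s hs).continuousWithinAt)
      (fun s hs => (hd s (interior_subset hs)).mono interior_subset) ?_
    intro s hs
    have := hacc s (interior_subset hs)
    linarith
  have hd : ∀ s ∈ I, HasDerivWithinAt
      (fun s => X s - X' t * (s - t) + g / 4 * (s - t) ^ 2)
      (X' s - X' t + g / 2 * (s - t)) I s := by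
    intro s hs
    have h1 := (hasDerivWithinAt_id s I).sub_const t
    have h := ((hX s hs).sub (h1.const_mul (X' t))).add ((h1.pow 2).const_mul (g / 4))
    refine h.congr_deriv ?_
    simp
    ring
  have ht : t ∈ I := ⟨by linarith, by linarith⟩
  have hsF : Set.Icc t (t + τF) ⊆ I := Set.Icc_subset_Icc (by linarith) le_rfl
  have hsB : Set.Icc (t - τB) t ⊆ I := Set.Icc_subset_Icc le_rfl (by linarith)
  have hF : AntitoneOn (fun s => X s - X' t * (s - t) + g / 4 * (s - t) ^ 2)
      (Set.Icc t (t + τF)) := by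
    refine antitoneOn_of_hasDerivWithinAt_nonpos
      (f' := fun s => X' s - X' t + g / 2 * (s - t)) (convex_Icc _ _)
      (fun s hs => ((hd s (hsF hs)).mono hsF).continuousWithinAt)
      (fun s hs => (hd s (hsF (interior_subset hs))).mono (interior_subset.trans hsF)) ?_
    intro s hs
    have hs' := interior_subset hs
    have := hA ht (hsF hs') hs'.1
    simp only at this
    linarith
  have hB : MonotoneOn (fun s => X s - X' t * (s - t) + g / 4 * (s - t) ^ 2)
      (Set.Icc (t - τB) t) := by
    refine monotoneOn_of_hasDerivWithinAt_nonneg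
      (f' := fun s => X' s - X' t + g / 2 * (s - t)) (convex_Icc _ _)
      (fun s hs => ((hd s (hsB hs)).mono hsB).continuousWithinAt)
      (fun s hs => (hd s (hsB (interior_subset hs))).mono (interior_subset.trans hsB)) ?_
    intro s hs
    have hs' := interior_subset hs
    have := hA (hsB hs') ht hs'.2
    simp only at this
    linarith
  have eF := hF (Set.left_mem_Icc.2 (by linarith)) (Set.right_mem_Icc.2 (by linarith))
    (by linarith : t ≤ t + τF)
  have eB := hB (Set.left_mem_Icc.2 (by linarith)) (Set.right_mem_Icc.2 (by linarith))
    (by linarith : t - τB ≤ t)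
  simp only [hexitF, hexitB] at eF eB
  have kF : g / 2 * τF - X' t ≤ Real.sqrt ((X' t) ^ 2 + g * X t) := by
    apply Real.le_sqrt_of_sq_le
    nlinarith [mul_le_mul_of_nonneg_left eF hg.le]
  have kB : g / 2 * τB + X' t ≤ Real.sqrt ((X' t) ^ 2 + g * X t) := by
    apply Real.le_sqrt_of_sq_le
    nlinarith [mul_le_mul_of_nonneg_left eB hg.le]
  rw [div_mul_eq_mul_div, le_div_iff₀ hg]
  linarith
end

section
/- Lemma (uniform bound for the potential of the flux divergence). Let g, β, T > 0 and let G(x,y) be a kernel on Ω×Ω of the form G(x,y) = |x₃−y₃|/2 − (x₃+y₃)/2 + (C₂/4)(1/|x−y| − 1/|x̃−y|) + b₀(x,y), where x̃ := (x∥, −x₃), the horizontal difference x∥−y∥ is taken in the fundamental domain [−1/2,1/2)², C₂ ∈ ℝ, and b₀ is C¹ in y with |b₀(x,y)| + |∇_y b₀(x,y)| ≤ C₀ min(1, e^{−|x₃−y₃|}). Let f : [0,T]×Ω×ℝ³ → ℝ be measurable with S := sup_{t∈[0,T]} ‖e^{(β/2)(|v|² + g x₃)} f(t)‖_{L∞(Ω×ℝ³)}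 < ∞, and set b(t,x) := ∫_{ℝ³} v f(t,x,v) dv. Then the function u(t,x) := −∫_Ω b(t,y)·∇_y G(x,y) dy is well defined and there is a constant C, depending only on |C₂| and C₀, such that sup_{t∈[0,T]} ‖u(t)‖_{L∞(Ω)} ≤ C (1 + 1/(βg)) β^{−2} S. -/
/-!
Statement 12 (Lemma 4.2): uniform bound for the potential of the flux divergence,
`‖Δ₀⁻¹(∇ₓ·b)(t)‖_{L∞(Ω)} ≤ C (1 + 1/(βg)) β⁻² S`.
-/

open MeasureTheory Real Set

noncomputable section

abbrev V3 : Type := Fin 3 → ℝ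

/-- Squared Euclidean length `|v|²`. -/
def sq3 (v : V3) : ℝ := ∑ i, (v i) ^ 2

/-- Partial derivative of a scalar function in the `i`-th coordinate direction. -/
def pd (i : Fin 3) (f : V3 → ℝ) (x : V3) : ℝ := fderiv ℝ f x (Pi.single i 1)

/-- Fundamental domain of `Ω = 𝕋² × (0,∞)`. -/
def Box : Set V3 :=
  {x | x 0 ∈ Set.Ico (-(1:ℝ)/2) (1/2) ∧ x 1 ∈ Set.Ico (-(1:ℝ)/2) (1/2) ∧ 0 < x 2}

/-- Representative in the fundamental domain `[-1/2, 1/2)` of the horizontal torus. -/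
def torRep (a : ℝ) : ℝ := a - round a

/-- Periodic Euclidean distance `|x − y|` (horizontal difference taken in `[-1/2,1/2)²`). -/
def dTor (x y : V3) : ℝ :=
  Real.sqrt ((torRep (x 0 - y 0)) ^ 2 + (torRep (x 1 - y 1)) ^ 2 + (x 2 - y 2) ^ 2)

/-- Periodic Euclidean distance `|x̃ − y|` with `x̃ = (x∥, −x₃)`. -/
def dTorRef (x y : V3) : ℝ :=
  Real.sqrt ((torRep (x 0 - y 0)) ^ 2 + (torRep (x 1 - y 1)) ^ 2 + (x 2 + y 2) ^ 2)

/-- The Green kernel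
`G(x,y) = |x₃−y₃|/2 − (x₃+y₃)/2 + (C₂/4)(1/|x−y| − 1/|x̃−y|) + b₀(x,y)`. -/
def GreenK (C₂ : ℝ) (b₀ : V3 → V3 → ℝ) (x y : V3) : ℝ :=
  |x 2 - y 2| / 2 - (x 2 + y 2) / 2 + C₂ / 4 * ((dTor x y)⁻¹ - (dTorRef x y)⁻¹) + b₀ x y

/-! ### One-dimensional singular integrals -/

/-- The weight `|s|^{-2/3}`. -/
def wt (s : ℝ) : ℝ := (|s| ^ ((2:ℝ)/3))⁻¹

lemma wt_nonneg (s : ℝ) : 0 ≤ wt s := by unfold wt; positivity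

lemma wt_neg (s : ℝ) : wt (-s) = wt s := by simp [wt]

lemma wt_meas : Measurable wt := by unfold wt; fun_prop

lemma one_le_wt {s : ℝ} (h0 : s ≠ 0) (h : |s| ≤ 1) : 1 ≤ wt s := by
  unfold wt
  have hs : 0 < |s| := abs_pos.2 h0
  exact (one_le_inv₀ (by positivity)).2 (Real.rpow_le_one hs.le h (by norm_num))

lemma wt_le_one {s : ℝ} (h : 1 ≤ |s|) : wt s ≤ 1 := by
  unfold wt
  exact inv_le_one_of_one_le₀ (Real.one_le_rpow h (by norm_num))

lemma wt_intervalIntegrable_pos (a : ℝ) (ha : 0 ≤ a) : IntervalIntegrable wt volume 0 a := by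
  have h := intervalIntegral.intervalIntegrable_rpow' (a := 0) (b := a) (r := -((2:ℝ)/3))
    (by norm_num)
  refine h.congr ?_
  intro s hs
  rw [uIoc_of_le ha] at hs
  simp only [wt]
  rw [Real.rpow_neg hs.1.le, abs_of_pos hs.1]

lemma wt_intervalIntegrable (a : ℝ) (ha : 0 ≤ a) : IntervalIntegrable wt volume (-a) a := by
  have h1 := wt_intervalIntegrable_pos a ha
  have h2 := (IntervalIntegrable.iff_comp_neg (f := wt)).1 h1
  simp only [wt_neg, neg_zero] at h2
  exact h2.symm.trans h1

lemma torRep_periodic : Function.Periodic torRep 1 := by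
  intro a
  simp [torRep, round_add_one]

lemma torRep_self {s : ℝ} (h1 : -(1/2) ≤ s) (h2 : s < 1/2) : torRep s = s := by
  have : round s = 0 := round_eq_zero_iff.2 ⟨h1, h2⟩
  simp [torRep, this]

lemma torRep_meas : Measurable torRep := by
  unfold torRep
  have : Measurable (fun a : ℝ => ((round a : ℤ) : ℝ)) := by
    simp only [round_eq]
    exact (measurable_of_countable _).comp (Int.measurable_floor.comp (by fun_prop))
  exact measurable_id.sub this

lemma wtor_base : IntervalIntegrable (fun s => wt (torRep s)) volume (-(1/2)) (-(1/2) + 1) := by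
  have h := wt_intervalIntegrable (1/2) (by norm_num)
  have e : (-(1/2) + 1 : ℝ) = 1/2 := by norm_num
  rw [e]
  refine h.congr_ae ?_
  rw [uIoc_of_le (by norm_num), ← Measure.restrict_congr_set Ico_ae_eq_Ioc]
  filter_upwards [ae_restrict_mem measurableSet_Ico] with s hs
  simp only [torRep_self hs.1 hs.2]

lemma wtor_periodic : Function.Periodic (fun s => wt (torRep s)) 1 := by
  intro s
  simp only [torRep_periodic s]

/-- The one-dimensional horizontal integral. -/
def Pc : ℝ := ∫ s in (-(1/2:ℝ))..(-(1/2) + 1), wt (torRep s)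

lemma Pc_nonneg : 0 ≤ Pc := by
  unfold Pc
  exact intervalIntegral.integral_nonneg (by norm_num) (fun s _ => wt_nonneg _)

/-- The horizontal factor of the dominating function. -/
def hor (a : ℝ) : ℝ → ℝ :=
  Set.indicator (Set.Ico (-(1:ℝ)/2) (1/2)) (fun y => wt (torRep (a - y)))

lemma hor_integrable (a : ℝ) : Integrable (hor a) ∧ ∫ y, hor a y = Pc := by
  have hI : ∀ c d : ℝ, IntervalIntegrable (fun s => wt (torRep s)) volume c d := fun c d =>
    wtor_periodic.intervalIntegrable (by norm_num) wtor_base c d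
  have h1 : IntervalIntegrable (fun y => wt (torRep (a - y))) volume (-(1:ℝ)/2) (1/2) := by
    have := (hI (a - (-(1:ℝ)/2)) (a - 1/2)).comp_sub_left a
    simpa using this
  constructor
  · unfold hor
    rw [integrable_indicator_iff measurableSet_Ico]
    exact (intervalIntegrable_iff_integrableOn_Ico_of_le (by norm_num)).1 h1
  · unfold hor
    rw [integral_indicator measurableSet_Ico, integral_Ico_eq_integral_Ioc,
      ← intervalIntegral.integral_of_le (by norm_num),
      intervalIntegral.integral_comp_sub_left (fun s => wt (torRep s)) a]
    have := wtor_periodic.intervalIntegral_add_eq (a - 1/2) (-(1/2))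
    unfold Pc
    rw [← this]
    congr 1
    ring

/-- The local vertical integral. -/
def Jc : ℝ := ∫ s, Set.indicator (Set.Ioc (-1:ℝ) 1) wt s

lemma Jc_nonneg : 0 ≤ Jc :=
  integral_nonneg (fun s => Set.indicator_nonneg (fun s _ => wt_nonneg s) s)

/-- The vertical factor of the dominating function. -/
def ver (c a : ℝ) (y : ℝ) : ℝ :=
  Set.indicator (Set.Ioi (0:ℝ)) (fun y => Real.exp (-c * y)) y
    + Set.indicator (Set.Ioc (-1:ℝ) 1) wt (a - y)

lemma ver_integrable (c a : ℝ) (hc : 0 < c) :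
    Integrable (ver c a) ∧ ∫ y, ver c a y = 1 / c + Jc := by
  have h1 : Integrable (Set.indicator (Set.Ioi (0:ℝ)) (fun y => Real.exp (-c * y))) := by
    rw [integrable_indicator_iff measurableSet_Ioi]
    exact exp_neg_integrableOn_Ioi 0 hc
  have h2 : Integrable (Set.indicator (Set.Ioc (-1:ℝ) 1) wt) := by
    rw [integrable_indicator_iff measurableSet_Ioc]
    have := wt_intervalIntegrable 1 (by norm_num)
    exact (intervalIntegrable_iff_integrableOn_Ioc_of_le (by norm_num)).1 this
  have h3 : Integrable (fun y => Set.indicator (Set.Ioc (-1:ℝ) 1) wt (a - y)) := h2.comp_sub_left a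
  constructor
  · exact h1.add h3
  · unfold ver
    rw [integral_add h1 h3, integral_indicator measurableSet_Ioi,
      integral_exp_mul_Ioi (by linarith), integral_sub_left_eq_self _ volume a]
    unfold Jc
    simp [neg_div_neg_eq]

lemma ver_nonneg (c a y : ℝ) : 0 ≤ ver c a y :=
  add_nonneg (Set.indicator_nonneg (fun s _ => (Real.exp_pos _).le) y)
    (Set.indicator_nonneg (fun s _ => wt_nonneg s) _)

lemma exp_le_ver {c a y : ℝ} (hy : 0 < y) : Real.exp (-c * y) ≤ ver c a y := by
  unfold ver
  rw [Set.indicator_of_mem (Set.mem_Ioi.2 hy)]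
  exact le_add_of_nonneg_right (Set.indicator_nonneg (fun s _ => wt_nonneg s) _)

lemma exp_wt_le_ver {c a y : ℝ} (hc : 0 < c) (hy : 0 < y) :
    Real.exp (-c * y) * wt (a - y) ≤ ver c a y := by
  unfold ver
  rw [Set.indicator_of_mem (Set.mem_Ioi.2 hy)]
  have hE : Real.exp (-c * y) ≤ 1 := Real.exp_le_one_iff.2 (by nlinarith [mul_pos hc hy])
  have hE0 := Real.exp_pos (-c * y)
  by_cases h : (a - y) ∈ Set.Ioc (-1:ℝ) 1
  · rw [Set.indicator_of_mem h]
    nlinarith [wt_nonneg (a - y)]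
  · rw [Set.indicator_of_notMem h]
    have : 1 ≤ |a - y| := by
      by_contra hh
      push Not at hh
      rw [abs_lt] at hh
      exact h ⟨hh.1, hh.2.le⟩
    nlinarith [wt_le_one this]

lemma inv_sq_le_wt {a b c : ℝ} (ha : a ≠ 0) (hb : b ≠ 0) (hc : c ≠ 0) :
    (a ^ 2 + b ^ 2 + c ^ 2)⁻¹ ≤ wt a * wt b * wt c := by
  have key : ∀ s : ℝ, (|s| ^ ((2:ℝ)/3)) ^ 3 = s ^ 2 := by
    intro s
    rw [← Real.rpow_natCast, ← Real.rpow_mul (abs_nonneg s)]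
    norm_num
  have pos : ∀ s : ℝ, s ≠ 0 → 0 < |s| ^ ((2:ℝ)/3) := fun s hs =>
    Real.rpow_pos_of_pos (abs_pos.2 hs) _
  unfold wt
  rw [← mul_inv, ← mul_inv, ← key a, ← key b, ← key c]
  have h1 := pos a ha
  have h2 := pos b hb
  have h3 := pos c hc
  generalize |a| ^ ((2:ℝ)/3) = X at *
  generalize |b| ^ ((2:ℝ)/3) = Y at *
  generalize |c| ^ ((2:ℝ)/3) = Z at *
  apply inv_anti₀ (by positivity)
  nlinarith [mul_nonneg (add_pos (add_pos h1 h2) h3).le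
    (add_nonneg (add_nonneg (sq_nonneg (X - Y)) (sq_nonneg (Y - Z))) (sq_nonneg (Z - X))),
    mul_pos (mul_pos h1 h2) h3]

/-! ### Gaussian moment -/

/-- The first Gaussian moment. -/
def Kc (i : Fin 3) : ℝ := ∫ v : V3, |v i| * Real.exp (-(1/2) * sq3 v)

lemma Kc_nonneg (i : Fin 3) : 0 ≤ Kc i := integral_nonneg (fun v => by positivity)

lemma gauss_integrable (i : Fin 3) {b : ℝ} (hb : 0 < b) :
    Integrable (fun v : V3 => |v i| * Real.exp (-b * sq3 v)) := by
  have h : ∀ j : Fin 3, Integrable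
      (fun s : ℝ => (if j = i then |s| else 1) * Real.exp (-b * s ^ 2)) := by
    intro j
    split_ifs
    · have := (integrable_mul_exp_neg_mul_sq hb).abs
      simpa [abs_mul] using this
    · simpa using integrable_exp_neg_mul_sq hb
  have := Integrable.fintype_prod (μ := fun _ : Fin 3 => (volume : Measure ℝ)) h
  refine this.congr (Filter.Eventually.of_forall fun v => ?_)
  simp only [Finset.prod_mul_distrib, ← Real.exp_sum, sq3, Finset.mul_sum]
  simp [Finset.prod_ite_eq]

lemma gauss_scale (i : Fin 3) {β : ℝ} (hβ : 0 < β) :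
    ∫ v : V3, |v i| * Real.exp (-(β/2) * sq3 v) = (β ^ 2)⁻¹ * Kc i := by
  have h := Measure.integral_comp_smul (volume : Measure V3)
    (fun v : V3 => |v i| * Real.exp (-(1/2) * sq3 v)) (Real.sqrt β)
  have hs : 0 < Real.sqrt β := Real.sqrt_pos.2 hβ
  have h2 : ∀ v : V3, |(Real.sqrt β • v) i| * Real.exp (-(1/2) * sq3 (Real.sqrt β • v))
      = Real.sqrt β * (|v i| * Real.exp (-(β/2) * sq3 v)) := by
    intro v
    have : sq3 (Real.sqrt β • v) = β * sq3 v := by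
      simp only [sq3, Pi.smul_apply, smul_eq_mul, mul_pow, Real.sq_sqrt hβ.le, Finset.mul_sum]
    rw [this, Pi.smul_apply, smul_eq_mul, abs_mul, abs_of_pos hs, mul_assoc]
    congr 3
    ring
  simp only [h2] at h
  rw [integral_const_mul] at h
  simp only [Module.finrank_fintype_fun_eq_card, Fintype.card_fin, smul_eq_mul] at h
  rw [abs_of_pos (by positivity)] at h
  change _ = _ * Kc i at h
  have e : β ^ 2 = Real.sqrt β * Real.sqrt β ^ 3 := by
    have := Real.sq_sqrt hβ.le
    calc β ^ 2 = (Real.sqrt β ^ 2) ^ 2 := by rw [this]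
      _ = _ := by ring
  rw [e, mul_inv, mul_assoc, ← h]
  field_simp

lemma flux_bound (i : Fin 3) {β E S : ℝ} (hβ : 0 < β) (F : V3 → ℝ)
    (hF : ∀ v, Real.exp (β / 2 * (sq3 v + E)) * |F v| ≤ S) :
    |∫ v : V3, v i * F v| ≤ (β ^ 2)⁻¹ * Kc i * (S * Real.exp (-(β/2) * E)) := by
  rw [← gauss_scale i hβ, ← integral_mul_const, ← Real.norm_eq_abs]
  refine norm_integral_le_of_norm_le ((gauss_integrable i (by positivity)).mul_const _)
    (Filter.Eventually.of_forall fun v => ?_)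
  rw [Real.norm_eq_abs, abs_mul, mul_assoc]
  refine mul_le_mul_of_nonneg_left ?_ (abs_nonneg _)
  have h := hF v
  have e : Real.exp (-(β/2) * sq3 v) * (S * Real.exp (-(β/2) * E))
      = S * (Real.exp (β / 2 * (sq3 v + E)))⁻¹ := by
    rw [← Real.exp_neg, mul_left_comm, ← Real.exp_add]
    congr 2
    ring
  rw [e, ← div_eq_mul_inv, le_div_iff₀ (Real.exp_pos _), mul_comm]
  exact h

/-! ### Gradient of the kernel -/

lemma inv_sqrt_fderiv {q : V3 → ℝ} {q' : V3 →L[ℝ] ℝ} {y e : V3} (hq : HasFDerivAt q q' y)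
    (hpos : 0 < q y) (hb : |q' e| ≤ 2 * Real.sqrt (q y)) :
    DifferentiableAt ℝ (fun y => (Real.sqrt (q y))⁻¹) y ∧
      |fderiv ℝ (fun y => (Real.sqrt (q y))⁻¹) y e| ≤ (q y)⁻¹ := by
  have hs : 0 < Real.sqrt (q y) := Real.sqrt_pos.2 hpos
  have h1 : HasDerivAt (fun s => (Real.sqrt s)⁻¹)
      (-(1 / (2 * Real.sqrt (q y))) / (Real.sqrt (q y)) ^ 2) (q y) :=
    (Real.hasDerivAt_sqrt hpos.ne').inv hs.ne'
  have h2 := h1.comp_hasFDerivAt y hq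
  refine ⟨h2.differentiableAt, ?_⟩
  have h3 : fderiv ℝ (fun y => (Real.sqrt (q y))⁻¹) y = _ := h2.fderiv
  rw [h3]
  simp only [ContinuousLinearMap.smul_apply, smul_eq_mul, abs_mul]
  rw [abs_div, abs_neg, abs_of_pos (by positivity : 0 < 1 / (2 * Real.sqrt (q y))),
    abs_of_pos (by positivity : 0 < Real.sqrt (q y) ^ 2), Real.sq_sqrt hpos.le]
  calc 1 / (2 * Real.sqrt (q y)) / q y * |q' e|
      ≤ 1 / (2 * Real.sqrt (q y)) / q y * (2 * Real.sqrt (q y)) := by gcongr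
    _ = (q y)⁻¹ := by field_simp

/-- `a` is not a half-integer. -/
def Good (a : ℝ) : Prop := ∀ n : ℤ, a ≠ n / 2

lemma Good.ne {a : ℝ} (h : Good a) : torRep a ≠ 0 := by
  intro h0
  apply h (2 * round a)
  unfold torRep at h0
  push_cast
  linarith

lemma Good.hasDerivAt {a : ℝ} (h : Good a) : HasDerivAt torRep 1 a := by
  have h1 : a ∈ Set.Ico ((round a : ℝ) - 1/2) (round a + 1/2) := round_eq_iff.1 rfl
  have h2 : a ≠ (round a : ℝ) - 1/2 := by
    have := h (2 * round a - 1)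
    push_cast at this
    intro h3
    apply this
    linarith
  have h3 : a ∈ Set.Ioo ((round a : ℝ) - 1/2) (round a + 1/2) :=
    ⟨lt_of_le_of_ne h1.1 h2.symm, h1.2⟩
  have h4 : torRep =ᶠ[nhds a] fun s => s - (round a : ℝ) := by
    filter_upwards [Ioo_mem_nhds h3.1 h3.2] with s hs
    have : round s = round a := round_eq_iff.2 ⟨hs.1.le, hs.2⟩
    simp [torRep, this]
  exact ((hasDerivAt_id a).sub_const _).congr_of_eventuallyEq h4

lemma hasFDerivAt_coord (j : Fin 3) (y : V3) :
    HasFDerivAt (fun y : V3 => y j) (ContinuousLinearMap.proj (R := ℝ) (φ := fun _ : Fin 3 => ℝ) j) y :=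
  (ContinuousLinearMap.proj (R := ℝ) (φ := fun _ : Fin 3 => ℝ) j).hasFDerivAt

lemma quad_deriv {x y : V3} (w : V3 → ℝ) (σ : ℝ) (hσ : |σ| = 1)
    (hw : HasFDerivAt w (σ • ContinuousLinearMap.proj (R := ℝ) (φ := fun _ : Fin 3 => ℝ) 2) y)
    (h0 : Good (x 0 - y 0)) (h1 : Good (x 1 - y 1)) (i : Fin 3) :
    DifferentiableAt ℝ (fun y => (Real.sqrt ((torRep (x 0 - y 0)) ^ 2 + (torRep (x 1 - y 1)) ^ 2
      + (w y) ^ 2))⁻¹) y ∧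
    |pd i (fun y => (Real.sqrt ((torRep (x 0 - y 0)) ^ 2 + (torRep (x 1 - y 1)) ^ 2
      + (w y) ^ 2))⁻¹) y| ≤ ((torRep (x 0 - y 0)) ^ 2 + (torRep (x 1 - y 1)) ^ 2
      + (w y) ^ 2)⁻¹ := by
  have d0 := h0.hasDerivAt.comp_hasFDerivAt y ((hasFDerivAt_coord 0 y).const_sub (x 0))
  have d1 := h1.hasDerivAt.comp_hasFDerivAt y ((hasFDerivAt_coord 1 y).const_sub (x 1))
  have dq := ((d0.pow 2).add (d1.pow 2)).add (hw.pow 2)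
  have hp0 : 0 < torRep (x 0 - y 0) ^ 2 := by have := h0.ne; positivity
  refine inv_sqrt_fderiv (q := fun y => (torRep (x 0 - y 0)) ^ 2 + (torRep (x 1 - y 1)) ^ 2
      + (w y) ^ 2) (e := Pi.single i 1) dq (by positivity) ?_
  have ha : |torRep (x 0 - y 0)| ≤ Real.sqrt ((torRep (x 0 - y 0)) ^ 2 + (torRep (x 1 - y 1)) ^ 2
      + (w y) ^ 2) := Real.abs_le_sqrt (by nlinarith [sq_nonneg (torRep (x 1 - y 1)), sq_nonneg (w y)])
  have hb : |torRep (x 1 - y 1)| ≤ Real.sqrt ((torRep (x 0 - y 0)) ^ 2 + (torRep (x 1 - y 1)) ^ 2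
      + (w y) ^ 2) := Real.abs_le_sqrt (by nlinarith [sq_nonneg (torRep (x 1 - y 1)), sq_nonneg (w y)])
  have hc : |w y| ≤ Real.sqrt ((torRep (x 0 - y 0)) ^ 2 + (torRep (x 1 - y 1)) ^ 2
      + (w y) ^ 2) := Real.abs_le_sqrt (by nlinarith [sq_nonneg (torRep (x 1 - y 1)), sq_nonneg (w y)])
  fin_cases i
  · simpa [abs_mul] using ha
  · simpa [abs_mul] using hb
  · simpa [abs_mul, hσ] using hc

lemma kernel_grad {C₂ C₀ : ℝ} {b₀ : V3 → V3 → ℝ} {x y : V3} (hx : 0 ≤ x 2) (hy : 0 < y 2)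
    (hd : DifferentiableAt ℝ (fun y => b₀ x y) y)
    (hb : |b₀ x y| + Real.sqrt (∑ i, (pd i (fun y' => b₀ x y') y) ^ 2)
            ≤ C₀ * min 1 (Real.exp (-|x 2 - y 2|))) (hC₀ : 0 ≤ C₀)
    (h0 : Good (x 0 - y 0)) (h1 : Good (x 1 - y 1)) (h2 : y 2 ≠ x 2) (i : Fin 3) :
    |pd i (fun y' => GreenK C₂ b₀ x y') y| ≤ 1 + C₀ + |C₂| *
      (wt (torRep (x 0 - y 0)) * wt (torRep (x 1 - y 1)) * wt (x 2 - y 2)) := by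
  have c2 := hasFDerivAt_coord 2 y
  obtain ⟨D1, B1⟩ := quad_deriv (fun y => x 2 - y 2) (-1) (by simp)
    ((c2.const_sub (x 2)).congr_fderiv (by ext; simp)) h0 h1 i
  obtain ⟨D2, B2⟩ := quad_deriv (fun y => x 2 + y 2) 1 (by simp)
    (by rw [one_smul]; exact c2.const_add (x 2)) h0 h1 i
  change DifferentiableAt ℝ (fun y => (dTor x y)⁻¹) y at D1
  change |pd i (fun y => (dTor x y)⁻¹) y| ≤ _ at B1
  change DifferentiableAt ℝ (fun y => (dTorRef x y)⁻¹) y at D2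
  change |pd i (fun y => (dTorRef x y)⁻¹) y| ≤ _ at B2
  have hne : x 2 - y 2 ≠ 0 := fun h => h2 (by linarith)
  have W := inv_sq_le_wt h0.ne h1.ne hne
  have hp0 : 0 < torRep (x 0 - y 0) ^ 2 := by have := h0.ne; positivity
  have W2 : (torRep (x 0 - y 0) ^ 2 + torRep (x 1 - y 1) ^ 2 + (x 2 + y 2) ^ 2)⁻¹ ≤
      (torRep (x 0 - y 0) ^ 2 + torRep (x 1 - y 1) ^ 2 + (x 2 - y 2) ^ 2)⁻¹ := by
    apply inv_anti₀ (by positivity)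
    nlinarith [mul_nonneg hx hy.le]
  -- the one-dimensional part
  obtain ⟨L, hL, BL⟩ : ∃ L : V3 →L[ℝ] ℝ,
      HasFDerivAt (fun y : V3 => |x 2 - y 2| / 2 - (x 2 + y 2) / 2) L y ∧
        |L (Pi.single i 1)| ≤ 1 := by
    rcases lt_or_gt_of_ne hne with h | h
    · have a1 := ((hasDerivAt_abs_neg h).comp_hasFDerivAt y (c2.const_sub (x 2))).mul_const (2:ℝ)⁻¹
      have a2 := (c2.const_add (x 2)).mul_const (2:ℝ)⁻¹
      refine ⟨_, (a1.sub a2).congr_of_eventuallyEq (Filter.Eventually.of_forall fun z => by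
        simp [div_eq_mul_inv]), ?_⟩
      fin_cases i <;> simp
    · have a1 := ((hasDerivAt_abs_pos h).comp_hasFDerivAt y (c2.const_sub (x 2))).mul_const (2:ℝ)⁻¹
      have a2 := (c2.const_add (x 2)).mul_const (2:ℝ)⁻¹
      refine ⟨_, (a1.sub a2).congr_of_eventuallyEq (Filter.Eventually.of_forall fun z => by
        simp [div_eq_mul_inv]), ?_⟩
      fin_cases i <;> simp <;> norm_num
  have hG := (hL.add ((D1.hasFDerivAt.sub D2.hasFDerivAt).const_mul (C₂ / 4))).add hd.hasFDerivAt
  have hG' : pd i (fun y' => GreenK C₂ b₀ x y') y = L (Pi.single i 1)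
      + C₂ / 4 * (pd i (fun y => (dTor x y)⁻¹) y - pd i (fun y => (dTorRef x y)⁻¹) y)
      + pd i (fun y' => b₀ x y') y := by
    have := hG.fderiv
    unfold pd
    change fderiv ℝ (fun y' => GreenK C₂ b₀ x y') y = _ at this
    rw [this]
    simp
  have B3 : |pd i (fun y' => b₀ x y') y| ≤ C₀ := by
    have s1 : |pd i (fun y' => b₀ x y') y| ≤ Real.sqrt (∑ i, (pd i (fun y' => b₀ x y') y) ^ 2) :=
      Real.abs_le_sqrt (Finset.single_le_sum (f := fun i => (pd i (fun y' => b₀ x y') y) ^ 2)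
        (fun j _ => sq_nonneg _) (Finset.mem_univ i))
    have s2 : C₀ * min 1 (Real.exp (-|x 2 - y 2|)) ≤ C₀ * 1 :=
      mul_le_mul_of_nonneg_left (min_le_left _ _) hC₀
    have := abs_nonneg (b₀ x y)
    linarith
  rw [hG']
  set w := wt (torRep (x 0 - y 0)) * wt (torRep (x 1 - y 1)) * wt (x 2 - y 2) with hw
  have hw0 : 0 ≤ w := mul_nonneg (mul_nonneg (wt_nonneg _) (wt_nonneg _)) (wt_nonneg _)
  have B4 : |C₂ / 4 * (pd i (fun y => (dTor x y)⁻¹) y - pd i (fun y => (dTorRef x y)⁻¹) y)|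
      ≤ |C₂| * w := by
    rw [abs_mul, abs_div]
    have := abs_sub (pd i (fun y => (dTor x y)⁻¹) y) (pd i (fun y => (dTorRef x y)⁻¹) y)
    have h4 : |(4:ℝ)| = 4 := by norm_num
    rw [h4]
    have h5 : |pd i (fun y => (dTor x y)⁻¹) y - pd i (fun y => (dTorRef x y)⁻¹) y| ≤ 2 * w := by
      linarith
    calc _ ≤ |C₂| / 4 * (2 * w) := by gcongr
      _ ≤ |C₂| * w := by nlinarith [mul_nonneg (abs_nonneg C₂) hw0]
  have t1 := abs_add_le (L (Pi.single i 1)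
      + C₂ / 4 * (pd i (fun y => (dTor x y)⁻¹) y - pd i (fun y => (dTorRef x y)⁻¹) y))
      (pd i (fun y' => b₀ x y') y)
  have t2 := abs_add_le (L (Pi.single i 1))
      (C₂ / 4 * (pd i (fun y => (dTor x y)⁻¹) y - pd i (fun y => (dTorRef x y)⁻¹) y))
  linarith

lemma ae_good (a : ℝ) (j : Fin 3) : ∀ᵐ y : V3, Good (a - y j) := by
  have h1 : ∀ᵐ s : ℝ, Good (a - s) := by
    have hc : (Set.range (fun n : ℤ => a - (n:ℝ) / 2)).Countable := Set.countable_range _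
    filter_upwards [hc.ae_notMem volume] with s hs n hn
    exact hs ⟨n, by simp only; linarith⟩
  exact (Measure.tendsto_eval_ae_ae (μ := fun _ : Fin 3 => (volume : Measure ℝ)) (i := j)).eventually h1

/-- The dominating function. -/
def dom (c : ℝ) (x y : V3) : ℝ := hor (x 0) (y 0) * hor (x 1) (y 1) * ver c (x 2) (y 2)

lemma dom_integrable {c : ℝ} (hc : 0 < c) (x : V3) :
    Integrable (dom c x) ∧ ∫ y, dom c x y = Pc * Pc * (1 / c + Jc) := by
  let F : Fin 3 → ℝ → ℝ := ![hor (x 0), hor (x 1), ver c (x 2)]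
  have e : dom c x = fun y => ∏ j, F j (y j) := by
    funext y
    simp [dom, F, Fin.prod_univ_three]
  have hF : ∀ j, Integrable (F j) := by
    intro j
    fin_cases j
    · exact (hor_integrable _).1
    · exact (hor_integrable _).1
    · exact (ver_integrable _ _ hc).1
  rw [e]
  refine ⟨Integrable.fintype_prod (μ := fun _ : Fin 3 => (volume : Measure ℝ)) hF, ?_⟩
  rw [integral_fintype_prod_volume_eq_prod, Fin.prod_univ_three]
  simp [F, (hor_integrable _).2, (ver_integrable _ _ hc).2]

lemma dom_nonneg (c : ℝ) (x y : V3) : 0 ≤ dom c x y :=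
  mul_nonneg (mul_nonneg (Set.indicator_nonneg (fun _ _ => wt_nonneg _) _)
    (Set.indicator_nonneg (fun _ _ => wt_nonneg _) _)) (ver_nonneg _ _ _)

lemma exp_mul_le_dom {c A B : ℝ} (hc : 0 < c) (hA : 0 ≤ A) (hB : 0 ≤ B) {x y : V3} (hy : y ∈ Box)
    (h0 : Good (x 0 - y 0)) (h1 : Good (x 1 - y 1)) :
    Real.exp (-c * y 2) * (A + B *
      (wt (torRep (x 0 - y 0)) * wt (torRep (x 1 - y 1)) * wt (x 2 - y 2)))
      ≤ (A + B) * dom c x y := by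
  obtain ⟨y0, y1, y2⟩ := hy
  have hd : dom c x y = wt (torRep (x 0 - y 0)) * wt (torRep (x 1 - y 1)) * ver c (x 2) (y 2) := by
    unfold dom hor
    rw [Set.indicator_of_mem y0, Set.indicator_of_mem y1]
  have u0 : 1 ≤ wt (torRep (x 0 - y 0)) := one_le_wt h0.ne
    ((abs_sub_round _).trans (by norm_num))
  have u1 : 1 ≤ wt (torRep (x 1 - y 1)) := one_le_wt h1.ne
    ((abs_sub_round _).trans (by norm_num))
  have v1 := exp_le_ver (c := c) (a := x 2) y2
  have v2 := exp_wt_le_ver (a := x 2) hc y2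
  have hv := ver_nonneg c (x 2) (y 2)
  rw [hd]
  set p := wt (torRep (x 0 - y 0)) * wt (torRep (x 1 - y 1)) with hp
  have p1 : 1 ≤ p := one_le_mul_of_one_le_of_one_le u0 u1
  have q1 : Real.exp (-c * y 2) ≤ p * ver c (x 2) (y 2) := by nlinarith
  have q2 : p * (Real.exp (-c * y 2) * wt (x 2 - y 2)) ≤ p * ver c (x 2) (y 2) := by gcongr
  nlinarith [mul_le_mul_of_nonneg_left q1 hA, mul_le_mul_of_nonneg_left q2 hB]

lemma box_meas : MeasurableSet Box := by
  have h0 : Measurable (fun y : V3 => y 0) := measurable_pi_apply 0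
  have h1 : Measurable (fun y : V3 => y 1) := measurable_pi_apply 1
  have h2 : Measurable (fun y : V3 => y 2) := measurable_pi_apply 2
  exact (h0 measurableSet_Ico).inter ((h1 measurableSet_Ico).inter (h2 measurableSet_Ioi))

/-- **Uniform bound for the potential of the flux divergence.** -/
theorem flux_potential_bound (C₂ C₀ : ℝ) (hC₀ : 0 ≤ C₀) :
    ∃ C : ℝ, 0 < C ∧
      ∀ (g β T : ℝ) (b₀ : V3 → V3 → ℝ) (f : ℝ → V3 → V3 → ℝ) (S : ℝ),
        0 < g → 0 < β → 0 < T →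
        -- b₀ is C¹ in y with the stated bound
        (∀ x : V3, Differentiable ℝ (fun y => b₀ x y)) →
        (∀ x y : V3,
          |b₀ x y| + Real.sqrt (∑ i, (pd i (fun y' => b₀ x y') y) ^ 2)
            ≤ C₀ * min 1 (Real.exp (-|x 2 - y 2|))) →
        -- f is measurable with finite weighted sup S
        Measurable (fun q : ℝ × V3 × V3 => f q.1 q.2.1 q.2.2) →
        (∀ t ∈ Set.Icc (0:ℝ) T, ∀ x v : V3, 0 ≤ x 2 →
          Real.exp (β / 2 * (sq3 v + g * x 2)) * |f t x v| ≤ S) →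
        ∀ t ∈ Set.Icc (0:ℝ) T, ∀ x : V3, 0 ≤ x 2 →
          -- u(t,x) = −∫_Ω b(t,y)·∇_y G(x,y) dy is well defined ...
          IntegrableOn
            (fun y : V3 => ∑ i, (∫ v : V3, v i * f t y v)
              * pd i (fun y' => GreenK C₂ b₀ x y') y) Box ∧
          -- ... and uniformly bounded
          |-(∫ y in Box, ∑ i, (∫ v : V3, v i * f t y v)
              * pd i (fun y' => GreenK C₂ b₀ x y') y)|
            ≤ C * (1 + 1 / (β * g)) * (β ^ 2)⁻¹ * S := by
  have hK : 0 ≤ ∑ i, Kc i := Finset.sum_nonneg fun i _ => Kc_nonneg i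
  have hP := Pc_nonneg
  have hJ := Jc_nonneg
  have hM : 0 ≤ 1 + C₀ + |C₂| := by positivity
  refine ⟨(∑ i, Kc i) * (1 + C₀ + |C₂|) * (Pc * Pc) * (2 + Jc) + 1, by positivity, ?_⟩
  intro g β T b₀ f S hg hβ hT hdiff hb hf hS t ht x hx
  have hS0 : 0 ≤ S := le_trans (by positivity) (hS t ht x 0 hx)
  have hc : 0 < β / 2 * g := by positivity
  obtain ⟨hI, hIe⟩ := dom_integrable hc x
  set D : ℝ := (β ^ 2)⁻¹ * (∑ i, Kc i) * S * (1 + C₀ + |C₂|) with hD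
  have hD0 : 0 ≤ D := by positivity
  have hmeas : AEStronglyMeasurable (fun y : V3 => ∑ i, (∫ v : V3, v i * f t y v)
              * pd i (fun y' => GreenK C₂ b₀ x y') y) (volume.restrict Box) := by
    refine (Measurable.aestronglyMeasurable ?_)
    refine Finset.measurable_sum _ fun i _ => ?_
    refine Measurable.mul ?_ (measurable_fderiv_apply_const ℝ _ _)
    have hm : Measurable (fun q : V3 × V3 => q.2 i * f t q.1 q.2) := by
      have h1 : Measurable (fun q : V3 × V3 => f t q.1 q.2) :=
        hf.comp (by fun_prop : Measurable (fun q : V3 × V3 => (t, q.1, q.2)))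
      exact ((measurable_pi_apply i).comp measurable_snd).mul h1
    exact (hm.stronglyMeasurable.integral_prod_right').measurable
  have hbound : ∀ᵐ y ∂(volume.restrict Box), ‖∑ i, (∫ v : V3, v i * f t y v)
              * pd i (fun y' => GreenK C₂ b₀ x y') y‖ ≤ D * dom (β / 2 * g) x y := by
    have hne : ∀ᵐ y : V3, y 2 ≠ x 2 :=
      (Measure.tendsto_eval_ae_ae (μ := fun _ : Fin 3 => (volume : Measure ℝ)) (i := 2)).eventually
        ((Set.countable_singleton (x 2)).ae_notMem volume)
    filter_upwards [ae_restrict_mem box_meas, ae_restrict_of_ae (ae_good (x 0) 0),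
      ae_restrict_of_ae (ae_good (x 1) 1), ae_restrict_of_ae hne] with y hy h0 h1 h2
    set w := wt (torRep (x 0 - y 0)) * wt (torRep (x 1 - y 1)) * wt (x 2 - y 2) with hw
    have hw0 : 0 ≤ w := mul_nonneg (mul_nonneg (wt_nonneg _) (wt_nonneg _)) (wt_nonneg _)
    have hk := fun i => kernel_grad (C₂ := C₂) hx hy.2.2 (hdiff x y) (hb x y) hC₀ h0 h1 h2 i
    have hfl := fun i => flux_bound i hβ (f t y) (fun v => hS t ht y v hy.2.2.le)
    have he := exp_mul_le_dom hc (by positivity : 0 ≤ 1 + C₀) (abs_nonneg C₂) hy h0 h1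
    rw [← hw] at he
    have e1 : Real.exp (-(β / 2) * (g * y 2)) = Real.exp (-(β / 2 * g) * y 2) := by
      congr 1
      ring
    calc ‖∑ i, (∫ v : V3, v i * f t y v) * pd i (fun y' => GreenK C₂ b₀ x y') y‖
        ≤ ∑ i, ‖(∫ v : V3, v i * f t y v) * pd i (fun y' => GreenK C₂ b₀ x y') y‖ :=
          norm_sum_le _ _
      _ ≤ ∑ i, ((β ^ 2)⁻¹ * Kc i * (S * Real.exp (-(β / 2 * g) * y 2)))
            * (1 + C₀ + |C₂| * w) := by
          refine Finset.sum_le_sum fun i _ => ?_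
          rw [norm_mul, Real.norm_eq_abs, Real.norm_eq_abs, ← e1]
          have := Kc_nonneg i
          exact mul_le_mul (hfl i) (hk i) (abs_nonneg _) (by positivity)
      _ = (β ^ 2)⁻¹ * (∑ i, Kc i) * S *
            (Real.exp (-(β / 2 * g) * y 2) * (1 + C₀ + |C₂| * w)) := by
          rw [← Finset.sum_mul, ← Finset.sum_mul, ← Finset.mul_sum]
          ring
      _ ≤ (β ^ 2)⁻¹ * (∑ i, Kc i) * S * ((1 + C₀ + |C₂|) * dom (β / 2 * g) x y) := by
          gcongr
      _ = D * dom (β / 2 * g) x y := by rw [hD]; ring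
  have hdomI : Integrable (fun y => D * dom (β / 2 * g) x y) := hI.const_mul D
  refine ⟨hdomI.integrableOn.mono' hmeas hbound, ?_⟩
  rw [abs_neg, ← Real.norm_eq_abs]
  calc _ ≤ ∫ y in Box, D * dom (β / 2 * g) x y :=
        norm_integral_le_of_norm_le hdomI.integrableOn hbound
    _ ≤ ∫ y, D * dom (β / 2 * g) x y :=
        setIntegral_le_integral hdomI
          (Filter.Eventually.of_forall fun y => mul_nonneg hD0 (dom_nonneg _ _ _))
    _ = D * (Pc * Pc * (2 * (1 / (β * g)) + Jc)) := by
        rw [integral_const_mul, hIe]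
        congr 3
        field_simp
    _ ≤ _ := by
        have hr : 0 ≤ 1 / (β * g) := by positivity
        generalize 1 / (β * g) = r at *
        have h1 : 2 * r + Jc ≤ (2 + Jc) * (1 + r) := by nlinarith [mul_nonneg hJ hr]
        calc D * (Pc * Pc * (2 * r + Jc)) ≤ D * (Pc * Pc * ((2 + Jc) * (1 + r))) := by gcongr
          _ ≤ D * (Pc * Pc * ((2 + Jc) * (1 + r))) + (1 + r) * (β ^ 2)⁻¹ * S :=
              le_add_of_nonneg_right (by positivity)
          _ = _ := by rw [hD]; ring

end
end
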